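/- Let α, β be positive reals with α·β = π². Then ∑_{n≥1} σ_{−1}(n) e^{−2nα} − ∑_{n≥1} σ_{−1}(n) e^{−2nβ} = (β − α)/12 + (1/4) log(α/β), where σ_{−1}(n) = ∑_{d∣n} 1/d. -/

import Mathlib

open Real

/-- Lambert series expansion: `∑ σ₋₁(n) xⁿ = -∑ log (1 - xᵐ)` for `0 ≤ x < 1`. -/
lemma tsum_sum_divisors_inv_mul_pow {x : ℝ} (hx0 : 0 ≤ x) (hx1 : x < 1) :
    ∑' n : ℕ, (∑ d ∈ (n + 1).divisors, (1 : ℝ) / d) * x ^ (n + 1) =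
      -∑' m : ℕ, Real.log (1 - x ^ (m + 1)) := by
  set f : ℕ+ × ℕ+ → ℝ := fun c ↦ x ^ (c.1 * c.2 : ℕ) / c.2 with hf_def
  have hf : Summable f := by
    have h := summable_prod_mul_pow (𝕜 := ℝ) 0 (r := x) (by rwa [Real.norm_of_nonneg hx0])
    refine h.of_nonneg_of_le (fun c ↦ by positivity) fun c ↦ ?_
    simpa [hf_def] using div_le_self (pow_nonneg hx0 _) (Nat.one_le_cast.mpr c.2.pos)
  have hlog (a : ℕ+) : ∑' b : ℕ+, f (a, b) = -Real.log (1 - x ^ (a : ℕ)) := by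
    have hxa : |x ^ (a : ℕ)| < 1 := by
      rw [abs_of_nonneg (by positivity)]
      exact pow_lt_one₀ hx0 hx1 a.ne_zero
    rw [← (Real.hasSum_pow_div_log_of_abs_lt_one hxa).tsum_eq,
      ← Nat.cast_one, tsum_pnat_eq_tsum_succ (f := fun b : ℕ ↦ x ^ ((a : ℕ) * b) / (b : ℝ))]
    simp [pow_mul]
  have hdiv (n : ℕ+) : ∑' c : (n : ℕ).divisorsAntidiagonal,
      f (sigmaAntidiagonalEquivProd ⟨n, c⟩) =
        (∑ d ∈ (n : ℕ).divisors, (1 : ℝ) / d) * x ^ (n : ℕ) := by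
    simp only [hf_def, sigmaAntidiagonalEquivProd, divisorsAntidiagonalFactors, PNat.mk_coe,
      Equiv.coe_fn_mk, tsum_fintype, Finset.univ_eq_attach]
    rw [(n : ℕ).divisorsAntidiagonal.sum_attach fun c : ℕ × ℕ ↦ x ^ (c.1 * c.2) / (c.2 : ℝ),
      Nat.sum_divisorsAntidiagonal' fun a b ↦ x ^ (a * b) / (b : ℝ), Finset.sum_mul]
    refine Finset.sum_congr rfl fun d hd ↦ ?_
    rw [Nat.div_mul_cancel (Nat.dvd_of_mem_divisors hd)]
    ring
  rw [← tsum_pnat_eq_tsum_succ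
      (f := fun n : ℕ ↦ (∑ d ∈ n.divisors, (1 : ℝ) / d) * x ^ n),
    ← tsum_pnat_eq_tsum_succ (f := fun m : ℕ ↦ Real.log (1 - x ^ m)), ← tsum_neg]
  simp_rw [← hdiv, ← hlog]
  rw [← hf.tsum_prod, ← sigmaAntidiagonalEquivProd.tsum_eq]
  exact (sigmaAntidiagonalEquivProd.summable_iff.mpr hf).tsum_sigma.symm

/-- On the imaginary axis, `log |η(it)| = -πt/12 + ∑ log (1 - e^{-2πnt})`. -/
lemma log_norm_eta_I_mul {t : ℝ} (ht : 0 < t) :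
    Real.log ‖ModularForm.eta (Complex.I * t)‖ =
      -π * t / 12 + ∑' n : ℕ, Real.log (1 - Real.exp (-2 * π * t) ^ (n + 1)) := by
  set x := Real.exp (-2 * π * t) with hx
  have hx1 : x < 1 := Real.exp_lt_one_iff.mpr (by nlinarith [mul_pos Real.pi_pos ht])
  have hq (n : ℕ) : ModularForm.eta_q n (Complex.I * t) = ((x ^ (n + 1) : ℝ) : ℂ) := by
    rw [ModularForm.eta_q_eq_pow, hx]
    push_cast
    congr 2
    linear_combination (2 * π * t : ℂ) * Complex.I_mul_I
  have hpos (n : ℕ) : 0 < 1 - x ^ (n + 1) :=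
    sub_pos.mpr (pow_lt_one₀ (Real.exp_pos _).le hx1 n.succ_ne_zero)
  have hsum : Summable fun n : ℕ ↦ Real.log (1 - x ^ (n + 1)) := by
    simp_rw [sub_eq_add_neg]
    refine Real.summable_log_one_add_of_summable (Summable.neg ?_)
    exact (summable_nat_add_iff 1).mpr (summable_geometric_of_lt_one (Real.exp_pos _).le hx1)
  have hprod : ‖∏' n : ℕ, (1 - ModularForm.eta_q n (Complex.I * t))‖ =
      ∏' n : ℕ, (1 - x ^ (n + 1)) := by
    rw [(ModularForm.multipliableLocallyUniformlyOn_eta.multipliable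
      (by simpa using ht)).norm_tprod]
    refine tprod_congr fun n ↦ ?_
    rw [hq, ← Complex.ofReal_one, ← Complex.ofReal_sub, Complex.norm_real,
      Real.norm_of_nonneg (hpos n).le]
  have hnorm : ‖Function.Periodic.qParam 24 (Complex.I * t)‖ = Real.exp (-π * t / 12) := by
    rw [Function.Periodic.norm_qParam]
    congr 1
    simp
    ring
  rw [ModularForm.eta, norm_mul, hprod, hnorm, ← Real.rexp_tsum_eq_tprod hpos hsum,
    ← Real.exp_add, Real.log_exp]

/-- The inversion formula for `log |η|` on the imaginary axis. -/
lemma log_norm_eta_I_mul_inv {t : ℝ} (ht : 0 < t) :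
    Real.log ‖ModularForm.eta (Complex.I * (t⁻¹ : ℝ))‖ =
      1 / 2 * Real.log t + Real.log ‖ModularForm.eta (Complex.I * t)‖ := by
  have hz : Complex.I * t ∈ UpperHalfPlane.upperHalfPlaneSet := by simpa using ht
  have h := ModularForm.eta_comp_eq_csqrt_I_inv hz
  have hinv : (-1 : ℂ) / (Complex.I * t) = Complex.I * (t⁻¹ : ℝ) := by
    have : (t : ℂ) ≠ 0 := by exact_mod_cast ht.ne'
    push_cast
    field_simp
    simp
  have hsqrt (z : ℂ) : ‖Complex.sqrt z‖ = ‖z‖ ^ (1 / 2 : ℝ) := by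
    rw [Complex.sqrt, ← Complex.norm_cpow_real]
    norm_num
  have hη : ‖ModularForm.eta (Complex.I * t)‖ ≠ 0 :=
    norm_ne_zero_iff.mpr (ModularForm.eta_ne_zero hz)
  simp only [Function.comp_apply, hinv, Pi.smul_apply, Pi.mul_apply, smul_eq_mul] at h
  rw [h, norm_mul, norm_mul, norm_inv, hsqrt, hsqrt, norm_mul, Complex.norm_I, Complex.norm_real,
    Real.norm_of_nonneg ht.le, Real.one_rpow, inv_one, one_mul, one_mul,
    Real.log_mul (by positivity) hη, Real.log_rpow ht]

/-- The `s → 1` specialization of the Ramanujan–Guinand formula: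
for `α, β > 0` with `αβ = π²`,
`∑ σ₋₁(n) e^{-2nα} - ∑ σ₋₁(n) e^{-2nβ} = (β-α)/12 + (1/4) log(α/β)`. -/
theorem ramanujan_guinand_s_eq_one (α β : ℝ) (hα : 0 < α) (hβ : 0 < β)
    (hαβ : α * β = π ^ 2) :
    (∑' n : ℕ, (∑ d ∈ (n + 1).divisors, (1 : ℝ) / d) * Real.exp (-2 * ((n : ℝ) + 1) * α)) -
      (∑' n : ℕ, (∑ d ∈ (n + 1).divisors, (1 : ℝ) / d) * Real.exp (-2 * ((n : ℝ) + 1) * β)) =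
      (β - α) / 12 + 1 / 4 * Real.log (α / β) := by
  have hlam {a t : ℝ} (ht : 0 < t) (ha : a = π * t) :
      ∑' n : ℕ, (∑ d ∈ (n + 1).divisors, (1 : ℝ) / d) * Real.exp (-2 * ((n : ℝ) + 1) * a) =
        -a / 12 - Real.log ‖ModularForm.eta (Complex.I * t)‖ := by
    have hx1 : Real.exp (-2 * π * t) < 1 :=
      Real.exp_lt_one_iff.mpr (by nlinarith [mul_pos Real.pi_pos ht])
    have hpow (n : ℕ) :
        Real.exp (-2 * ((n : ℝ) + 1) * a) = Real.exp (-2 * π * t) ^ (n + 1) := by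
      rw [← Real.exp_nat_mul, ha]
      push_cast
      ring_nf
    simp_rw [hpow]
    rw [log_norm_eta_I_mul ht, tsum_sum_divisors_inv_mul_pow (Real.exp_pos _).le hx1, ha]
    ring
  have ht : 0 < α / π := by positivity
  have hβ' : β = π * (α / π)⁻¹ := by
    field_simp
    linarith
  have hlog : Real.log (α / β) = 2 * Real.log (α / π) := by
    rw [← Nat.cast_ofNat, ← Real.log_pow, hβ']
    congr 1
    field_simp
  rw [hlam ht (by field_simp), hlam (inv_pos.mpr ht) hβ', log_norm_eta_I_mul_inv ht, hlog]
  ring
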